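/- Let F satisfy assumptions A1), A2), and A4). Then for every δ ∈ (0, 1/2] there exists T > 0 (depending on δ and y₀) such that for every y ≥ T one has Φ(δ F(y)) ≤ y^{2δ}. -/

import Mathlib

open MeasureTheory Real Set Filter
open scoped ENNReal

noncomputable section

/-- The surface measure (lower Minkowski content) `μ⁺(A)` of a set `A`:
`liminf_{h→0⁺} (μ(A^h) − μ(A))/h`, where `A^h = {x : dist(x,A) ≤ h}`. -/
def surfaceMeasure {d : ℕ} (μ : Measure (EuclideanSpace ℝ (Fin d)))
    (A : Set (EuclideanSpace ℝ (Fin d))) : ℝ :=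
  liminf (fun h : ℝ =>
    ((μ (Metric.cthickening h A)).toReal - (μ A).toReal) / h) (nhdsWithin 0 (Ioi 0))

/-- `I_F(r) = sup { μ(A) F(1/μ(A)) / μ⁺(A) : A Borel, μ(A) = 1 − μ(B_r) }`. -/
def isoF {d : ℕ} (μ : Measure (EuclideanSpace ℝ (Fin d))) (F : ℝ → ℝ) (r : ℝ) : ℝ :=
  sSup { z | ∃ A : Set (EuclideanSpace ℝ (Fin d)), MeasurableSet A ∧
    (μ A).toReal = 1 - (μ (Metric.closedBall 0 r)).toReal ∧
    z = (μ A).toReal * F (1 / (μ A).toReal) / surfaceMeasure μ A }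

/-- The isoperimetric function `𝓘_μ(t) = inf { μ⁺(A) : A Borel, μ(A) = t }`. -/
def isoProfile {d : ℕ} (μ : Measure (EuclideanSpace ℝ (Fin d))) (t : ℝ) : ℝ :=
  sInf { z | ∃ A : Set (EuclideanSpace ℝ (Fin d)), MeasurableSet A ∧
    (μ A).toReal = t ∧ z = surfaceMeasure μ A }

/-- The Legendre transform over `[0, ∞)`: `c*(x) = sup_{y ≥ 0} (xy − c(y))`. -/
def legendre (c : ℝ → ℝ) (x : ℝ) : ℝ :=
  sSup { z | ∃ y : ℝ, 0 ≤ y ∧ z = x * y - c y }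

/-- `Φ(x) = (yF(y) − y)^*(x) = sup_{y > 0} (xy − yF(y) + y)`. -/
def PhiF (F : ℝ → ℝ) (x : ℝ) : ℝ :=
  sSup { z | ∃ y : ℝ, 0 < y ∧ z = x * y - y * F y + y }

/-- The topological support of a measure. -/
def msupport {d : ℕ} (μ : Measure (EuclideanSpace ℝ (Fin d))) :
    Set (EuclideanSpace ℝ (Fin d)) :=
  { x | ∀ U : Set (EuclideanSpace ℝ (Fin d)), IsOpen U → x ∈ U → 0 < μ U }

/-- A convex (log-concave) measure: `μ = e^{-V} dx` for a convex `V : ℝ^d → ℝ ∪ {+∞}`,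
encoded by a finite convex function `V` on a convex domain `s` (with `V = +∞`,
i.e. density `0`, outside `s`). -/
def IsConvexMeasure {d : ℕ} (μ : Measure (EuclideanSpace ℝ (Fin d))) : Prop :=
  ∃ (s : Set (EuclideanSpace ℝ (Fin d))) (V : EuclideanSpace ℝ (Fin d) → ℝ),
    Convex ℝ s ∧ ConvexOn ℝ s V ∧
    μ = volume.withDensity (s.indicator (fun x => ENNReal.ofReal (exp (-V x))))

/-- `Ent_μ g = ∫ g log (g / ∫ g dμ) dμ`. -/
def entropy {α : Type*} [MeasurableSpace α] (μ : Measure α) (g : α → ℝ) : ℝ :=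
  ∫ x, g x * log (g x / ∫ y, g y ∂μ) ∂μ

/-- `Var_μ f = ∫ f² dμ − (∫ f dμ)²`. -/
def var {α : Type*} [MeasurableSpace α] (μ : Measure α) (f : α → ℝ) : ℝ :=
  (∫ x, f x ^ 2 ∂μ) - (∫ x, f x ∂μ) ^ 2

/-- The cost function `c_{A,q}`. -/
def cA (A q x : ℝ) : ℝ :=
  if |x| ≤ A then x ^ 2 / 2 else A ^ (2 - q) * |x| ^ q / q + A ^ 2 * (q - 2) / (2 * q)

/-- The perturbation function `ψ_{τ,β}`. -/
def psi (τ β x : ℝ) : ℝ :=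
  if x ≤ 1 then x else β / 2 * ((1 + τ * (x - 1)) ^ (2 / (τ * β)) - 1) + 1

/-- The median `m_f = inf {t : μ(f > t) ≤ 1/2}`. -/
def median {α : Type*} [MeasurableSpace α] (μ : Measure α) (f : α → ℝ) : ℝ :=
  sInf { t : ℝ | μ { x | t < f x } ≤ 1/2 }

/-- The generalized entropy function `F_τ` built from `φ` (with `φ(x₀) = 1`). -/
def Ftau (φ : ℝ → ℝ) (x₀ τ x : ℝ) : ℝ :=
  if x ≤ x₀ then φ x else (φ x ^ τ - 1) / τ + 1

end

theorem deriv_pos_of_antitoneOn_mul_deriv {F : ℝ → ℝ} {y₀ : ℝ}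
    (hconc : ConcaveOn ℝ (Ioi 0) F) (hmono : StrictMonoOn F (Ioi 0)) (hy₀ : 0 < y₀)
    (hanti : AntitoneOn (fun y => y * deriv F y) (Ici y₀)) {x : ℝ} (hx : y₀ ≤ x) :
    0 < deriv F x := by
  by_contra! hneg
  have hx0 : 0 < x := hy₀.trans_le hx
  obtain ⟨z, hzx, hzdiff⟩ : ∃ z, x < z ∧ DifferentiableAt ℝ F z := by
    have hae := hmono.monotoneOn.ae_differentiableWithinAt measurableSet_Ioi
    have hae' : ∀ᵐ z ∂(volume.restrict (Ioi x)), DifferentiableWithinAt ℝ F (Ioi 0) z :=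
      ae_mono (Measure.restrict_mono (Ioi_subset_Ioi hx0.le) le_rfl) hae
    have hmem : ∀ᵐ z ∂(volume.restrict (Ioi x)), z ∈ Ioi x := ae_restrict_mem measurableSet_Ioi
    have : (ae (volume.restrict (Ioi x))).NeBot := by
      rw [ae_neBot, Ne, Measure.restrict_eq_zero]
      simp
    obtain ⟨z, hz, hzx⟩ := (hae'.and hmem).exists
    exact ⟨z, hzx, hz.differentiableAt (Ioi_mem_nhds (hx0.trans hzx))⟩
  have hz0 : 0 < z := hx0.trans hzx
  have hzneg : z * deriv F z ≤ 0 :=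
    (hanti hx (hx.trans hzx.le) hzx.le).trans (mul_nonpos_of_nonneg_of_nonpos hx0.le hneg)
  have hderiv : deriv F z ≤ 0 := by
    by_contra! h
    exact absurd (mul_pos hz0 h) (not_lt.2 hzneg)
  have hz1 : (0 : ℝ) < z + 1 := by linarith
  have hslope := hconc.slope_le_of_hasDerivAt (x := z) (y := z + 1) hz0 hz1 (by linarith)
    hzdiff.hasDerivAt
  rw [slope_def_field] at hslope
  have hlt := hmono (mem_Ioi.2 hz0) (mem_Ioi.2 hz1) (by linarith)
  have : F (z + 1) - F z ≤ 0 := by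
    have := hslope.trans hderiv
    simpa using this
  linarith

theorem hasDerivAt_comp_exp {F : ℝ → ℝ} {u : ℝ} (h : DifferentiableAt ℝ F (exp u)) :
    HasDerivAt (fun v => F (exp v)) (exp u * deriv F (exp u)) u := by
  rw [mul_comm]
  exact h.hasDerivAt.comp u (Real.hasDerivAt_exp u)

theorem exists_forall_neg_mul_le {F : ℝ → ℝ} (hmono : MonotoneOn F (Ioi 0))
    (hzero : Tendsto (fun y => y * F y) (nhdsWithin 0 (Ioi 0)) (nhds 0)) (b : ℝ) :
    ∃ M : ℝ, ∀ t, 0 < t → t < b → -(t * F t) ≤ M := by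
  have hev : ∀ᶠ t in nhdsWithin (0 : ℝ) (Ioi 0), -1 < t * F t :=
    hzero.eventually (lt_mem_nhds (by norm_num))
  obtain ⟨ε, hε, hball⟩ := (mem_nhdsGT_iff_exists_Ioo_subset).1 hev
  have hε0 : (0 : ℝ) < ε := hε
  refine ⟨1 + b * |F ε|, fun t ht htb => ?_⟩
  rcases lt_or_ge t ε with h | h
  · have h1 : -1 < t * F t := hball ⟨ht, h⟩
    have h2 : 0 ≤ b * |F ε| := mul_nonneg (ht.trans htb).le (abs_nonneg _)
    linarith
  · have h1 : F ε ≤ F t := hmono hε0 ht h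
    have h2 : -F t ≤ |F ε| := by linarith [neg_abs_le (F ε)]
    calc -(t * F t) = t * -F t := by ring
      _ ≤ t * |F ε| := by gcongr
      _ ≤ b * |F ε| := by gcongr
      _ ≤ 1 + b * |F ε| := by linarith

theorem eventually_mul_log_add_le_rpow (a b : ℝ) {p : ℝ} (hp : 0 < p) :
    ∀ᶠ y : ℝ in atTop, a * log y + b ≤ y ^ p := by
  have h1 : (fun y : ℝ => a * log y) =o[atTop] fun y => y ^ p :=
    (isLittleO_log_rpow_atTop hp).const_mul_left a
  have h2 : (fun _ : ℝ => b) =o[atTop] fun y : ℝ => y ^ p :=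
    Asymptotics.isLittleO_const_left.2
      (Or.inr (tendsto_norm_atTop_atTop.comp (tendsto_rpow_atTop hp)))
  filter_upwards [(h1.add h2).bound one_pos, eventually_ge_atTop 0] with y hy hy0
  rw [one_mul, Real.norm_of_nonneg (rpow_nonneg hy0 p)] at hy
  exact (le_abs_self _).trans hy

theorem stmt9 (F : ℝ → ℝ) (hA1_conc : ConcaveOn ℝ (Ioi 0) F) (hA1_mono : StrictMonoOn F (Ioi 0))
    (hA1_one : F 1 = 0)
    (hA2_zero : Tendsto (fun y => y * F y) (nhdsWithin 0 (Ioi 0)) (nhds 0))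
    (hA2_top : Tendsto F atTop atTop)
    (hA4 : ∃ y₀ : ℝ, 1 ≤ y₀ ∧ AntitoneOn (fun y => y * deriv F y) (Ici y₀) ∧
      ∀ y ∈ Ici y₀, y * deriv F y ≤ 1) :
    ∀ δ : ℝ, 0 < δ → δ ≤ 1 / 2 → ∃ T : ℝ, 0 < T ∧ ∀ y : ℝ, T ≤ y →
      PhiF F (δ * F y) ≤ y ^ (2 * δ) := by
  obtain ⟨y₀, hy₀, hanti, hle⟩ := hA4
  intro δ hδ hδ2
  have hy₀pos : 0 < y₀ := one_pos.trans_le hy₀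
  set v₀ := log y₀ with hv₀
  have hv₀nonneg : 0 ≤ v₀ := log_nonneg hy₀
  have hexp : ∀ {u : ℝ}, v₀ ≤ u → y₀ ≤ exp u := fun h => (log_le_iff_le_exp hy₀pos).1 h
  have hderiv : ∀ u, v₀ ≤ u →
      HasDerivAt (fun v => F (exp v)) (exp u * deriv F (exp u)) u := fun u hu =>
    hasDerivAt_comp_exp (differentiableAt_of_deriv_ne_zero
      (deriv_pos_of_antitoneOn_mul_deriv hA1_conc hA1_mono hy₀pos hanti (hexp hu)).ne')
  have hcont : ContinuousOn (fun v => F (exp v)) (Ici v₀) := fun u hu =>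
    (hderiv u hu).continuousAt.continuousWithinAt
  have hconc : ConcaveOn ℝ (Ici v₀) (fun v => F (exp v)) := by
    refine AntitoneOn.concaveOn_of_deriv (convex_Ici v₀) hcont ?_ ?_
    · rw [interior_Ici]
      exact fun u hu => (hderiv u (le_of_lt hu)).differentiableAt.differentiableWithinAt
    · rw [interior_Ici]
      intro u hu v hv huv
      rw [(hderiv u (le_of_lt hu)).deriv, (hderiv v (le_of_lt hv)).deriv]
      exact hanti (hexp (le_of_lt hu)) (hexp (le_of_lt hv)) (exp_le_exp.2 huv)
  have hlip : ∀ u v, v₀ ≤ u → u ≤ v → F (exp v) - F (exp u) ≤ v - u := by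
    intro u v hu huv
    have := (convex_Ici v₀).image_sub_le_mul_sub_of_deriv_le hcont
      (by
        rw [interior_Ici]
        exact fun u hu => (hderiv u (le_of_lt hu)).differentiableAt.differentiableWithinAt)
      (C := 1)
      (by
        rw [interior_Ici]
        intro u hu
        rw [(hderiv u (le_of_lt hu)).deriv]
        exact hle _ (hexp (le_of_lt hu)))
      u hu v (hu.trans huv) huv
    simpa using this
  obtain ⟨M, hM⟩ := exists_forall_neg_mul_le hA1_mono.monotoneOn hA2_zero y₀
  have hFy₀ : 0 ≤ F y₀ := by
    rw [← hA1_one]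
    exact hA1_mono.monotoneOn (mem_Ioi.2 one_pos) (mem_Ioi.2 hy₀pos) hy₀
  have hev : ∀ᶠ y in atTop, PhiF F (δ * F y) ≤ y ^ (2 * δ) := by
    filter_upwards [hA2_top.eventually_ge_atTop ((v₀ + 1) / δ),
      (tendsto_rpow_atTop (by linarith : 0 < 2 * δ)).eventually_ge_atTop y₀,
      eventually_ge_atTop y₀,
      eventually_mul_log_add_le_rpow (y₀ * δ) (y₀ * (δ * F y₀ + 1) + M)
        (by linarith : 0 < 2 * δ)] with y hL hs hy hsmall
    rw [div_le_iff₀' hδ] at hL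
    have hypos : 0 < y := hy₀pos.trans_le hy
    set s := y ^ (2 * δ) with hsdef
    have hspos : 0 < s := rpow_pos_of_pos hypos _
    have hlogs : log s = 2 * δ * log y := log_rpow hypos _
    have hv : v₀ ≤ log y := log_le_log hy₀pos hy
    have hvs : v₀ ≤ log s := log_le_log hy₀pos hs
    have hFs : 2 * δ * F y - v₀ ≤ F s := by
      have hc := hconc.2 (mem_Ici.2 hv) (mem_Ici.2 le_rfl) (by linarith : 0 ≤ 2 * δ)
        (by linarith : 0 ≤ 1 - 2 * δ) (by ring)
      simp only [smul_eq_mul] at hc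
      have hnn : 0 ≤ (1 - 2 * δ) * v₀ := mul_nonneg (by linarith) hv₀nonneg
      have hl := hlip (log s) (2 * δ * log y + (1 - 2 * δ) * v₀) hvs (by linarith)
      rw [exp_log hspos] at hl
      rw [exp_log hypos, exp_log hy₀pos] at hc
      have h3 : 0 ≤ (1 - 2 * δ) * F y₀ := mul_nonneg (by linarith) hFy₀
      have h4 : 0 ≤ δ * v₀ := mul_nonneg hδ.le hv₀nonneg
      linarith
    have hFy : F y ≤ F y₀ + log y := by
      have hl := hlip v₀ (log y) le_rfl hv
      rw [exp_log hypos, exp_log hy₀pos] at hl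
      linarith
    refine Real.sSup_le ?_ hspos.le
    rintro z ⟨t, ht, rfl⟩
    rcases lt_or_ge t y₀ with h0 | h0
    · have h1 := hM t ht h0
      have h2 : t * (δ * F y + 1) ≤ y₀ * (δ * (F y₀ + log y) + 1) := by
        have : 0 ≤ δ * F y + 1 := by linarith
        gcongr
      linarith
    rcases lt_or_ge t s with h | h
    · have hl := hlip (log t) (log s) (log_le_log hy₀pos h0) (log_le_log ht h.le)
      rw [exp_log hspos, exp_log ht] at hl
      have hlog : log s - log t ≤ s / t := by
        rw [← log_div hspos.ne' ht.ne']
        exact log_le_self (by positivity)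
      calc δ * F y * t - t * F t + t = t * (δ * F y - F t + 1) := by ring
        _ ≤ t * (s / t) := by
          gcongr
          linarith
        _ = s := by field_simp
    · have hF : F s ≤ F t := hA1_mono.monotoneOn (mem_Ioi.2 hspos) (mem_Ioi.2 ht) h
      have hneg : t * (δ * F y - F t + 1) ≤ 0 :=
        mul_nonpos_of_nonneg_of_nonpos ht.le (by linarith)
      linarith
  obtain ⟨T, hT⟩ := eventually_atTop.1 hev
  exact ⟨max T 1, lt_max_of_lt_right one_pos, fun y hy => hT y ((le_max_left _ _).trans hy)⟩
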